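/- Let d be a positive integer, 1 < p < ∞, let s be a positive integer with s > d/p, and let 1 ≤ q ≤ ∞. Define γ = s·(1/q − 1/p)^{−1} and α = s if q < p, and γ = ∞ and α = s − d(1/p − 1/q) if q ≥ p. Let δ > 0 and B = B(0,δ) ⊂ ℝ^d be the open Euclidean ball of radius δ. Then there exists a constant c > 0 such that for every nonempty finite point set P ⊂ B there exists an infinitely differentiable function f: ℝ^d → ℝ with: f ≥ 0 everywhere; the support of f is contained in B; f(x) = 0 for all x ∈ P; the Sobolev norm ( Σ_{k=0}^{s} ‖ x ↦ ‖D^k f(x)‖ ‖_{L_p(ℝ^d)}^p )^{1/p} is at most 1; and ‖f‖_{L_q(B)} ≥ c·‖dist(·, P)‖_{L_γ(B)}^α. -/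

import Mathlib

open MeasureTheory Metric

section Bump

variable {E : Type*} [NormedAddCommGroup E] [NormedSpace ℝ E] [FiniteDimensional ℝ E]

/-- A smooth function equal to `1` on the ball of radius `ρ / 2` about `y` and supported in the
ball of radius `ρ`; all these functions are rescaled translates of each other. -/
noncomputable def scaledBump (y : E) (ρ : ℝ) (x : E) : ℝ :=
  (⟨1 / 2, 1, by norm_num, by norm_num⟩ : ContDiffBump (0 : E)) (ρ⁻¹ • (x - y))

theorem contDiff_scaledBump (y : E) (ρ : ℝ) : ContDiff ℝ (⊤ : ℕ∞) (scaledBump y ρ) :=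
  (ContDiffBump.contDiff _).comp (by fun_prop)

theorem scaledBump_nonneg (y : E) (ρ : ℝ) (x : E) : 0 ≤ scaledBump y ρ x :=
  ContDiffBump.nonneg _

theorem scaledBump_eq_one {y x : E} {ρ : ℝ} (hρ : 0 < ρ) (hx : x ∈ closedBall y (ρ / 2)) :
    scaledBump y ρ x = 1 := by
  refine ContDiffBump.one_of_mem_closedBall _ ?_
  rw [mem_closedBall_iff_norm] at hx ⊢
  rw [sub_zero, norm_smul, norm_inv, Real.norm_of_nonneg hρ.le, inv_mul_le_iff₀ hρ]
  linarith

omit [FiniteDimensional ℝ E] in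
theorem inv_smul_sub_mem_closedBall_iff {y x : E} {ρ : ℝ} (hρ : 0 < ρ) :
    ρ⁻¹ • (x - y) ∈ closedBall (0 : E) 1 ↔ x ∈ closedBall y ρ := by
  rw [mem_closedBall_iff_norm, mem_closedBall_iff_norm, sub_zero, norm_smul, norm_inv,
    Real.norm_of_nonneg hρ.le, inv_mul_le_iff₀ hρ, mul_one]

theorem iteratedFDeriv_scaledBump_eq_zero {y x : E} {ρ : ℝ} (hρ : 0 < ρ)
    (hx : x ∉ closedBall y ρ) (k : ℕ) : iteratedFDeriv ℝ k (scaledBump y ρ) x = 0 := by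
  by_contra h
  refine hx ?_
  have h1 : x ∈ tsupport (scaledBump y ρ) := support_iteratedFDeriv_subset k h
  refine closure_minimal ?_ isClosed_closedBall h1
  intro z hz
  rw [← inv_smul_sub_mem_closedBall_iff hρ]
  have : ρ⁻¹ • (z - y) ∈ ball (0 : E) 1 := by
    rw [← (⟨1 / 2, 1, by norm_num, by norm_num⟩ : ContDiffBump (0 : E)).support_eq]
    exact hz
  exact ball_subset_closedBall this

theorem scaledBump_eq_zero {y x : E} {ρ : ℝ} (hρ : 0 < ρ) (hx : x ∉ closedBall y ρ) :
    scaledBump y ρ x = 0 := by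
  have h := iteratedFDeriv_scaledBump_eq_zero hρ hx 0
  rw [← norm_eq_zero, norm_iteratedFDeriv_zero] at h
  exact norm_eq_zero.1 h

theorem exists_norm_iteratedFDeriv_scaledBump_le (E : Type*) [NormedAddCommGroup E]
    [NormedSpace ℝ E] [FiniteDimensional ℝ E] (s : ℕ) :
    ∃ M : ℝ, 0 < M ∧ ∀ k ≤ s, ∀ (y : E) (ρ : ℝ), 0 < ρ → ∀ x,
      ‖iteratedFDeriv ℝ k (scaledBump y ρ) x‖ ≤ M * ρ⁻¹ ^ k := by
  set φ : ContDiffBump (0 : E) := ⟨1 / 2, 1, by norm_num, by norm_num⟩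
  have hc (k : ℕ) : ∃ M : ℝ, 0 ≤ M ∧ ∀ x, ‖iteratedFDeriv ℝ k φ x‖ ≤ M := by
    obtain ⟨M, hM⟩ := (φ.hasCompactSupport.iteratedFDeriv (𝕜 := ℝ) k).exists_bound_of_continuous
      ((φ.contDiff (n := (⊤ : ℕ∞))).continuous_iteratedFDeriv (by exact_mod_cast le_top))
    exact ⟨M, (norm_nonneg _).trans (hM 0), hM⟩
  choose M hM0 hM using hc
  refine ⟨1 + ∑ k ∈ Finset.range (s + 1), M k, by
    have := Finset.sum_nonneg fun k (_ : k ∈ Finset.range (s + 1)) => hM0 k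
    positivity, fun k hk y ρ hρ x => ?_⟩
  have h1 : iteratedFDeriv ℝ k (scaledBump y ρ) x
      = ρ⁻¹ ^ k • iteratedFDeriv ℝ k φ (ρ⁻¹ • (x - y)) := by
    have h2 : scaledBump y ρ = fun x => (fun z => φ (ρ⁻¹ • z)) (x - y) := rfl
    rw [h2, iteratedFDeriv_comp_sub (f := fun z => φ (ρ⁻¹ • z)),
      iteratedFDeriv_comp_const_smul _ φ.contDiff]
  rw [h1, norm_smul, norm_pow, norm_inv, Real.norm_of_nonneg hρ.le, mul_comm]
  gcongr
  refine (hM k _).trans ?_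
  have := Finset.single_le_sum (f := M) (fun k _ => hM0 k)
    (Finset.mem_range.2 (Nat.lt_succ_of_le hk))
  linarith

/-- A linear combination of scaled bumps. -/
noncomputable def bumpSum {ι : Type*} (I : Finset ι) (y : ι → E) (ρ a : ι → ℝ) (x : E) : ℝ :=
  ∑ i ∈ I, a i • scaledBump (y i) (ρ i) x

variable {ι : Type*} {I : Finset ι} {y : ι → E} {ρ a : ι → ℝ}

theorem contDiff_bumpSum (I : Finset ι) (y : ι → E) (ρ a : ι → ℝ) :
    ContDiff ℝ (⊤ : ℕ∞) (bumpSum I y ρ a) :=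
  ContDiff.sum fun i _ => (contDiff_scaledBump (y i) (ρ i)).const_smul (a i)

theorem bumpSum_nonneg (ha : ∀ i ∈ I, 0 ≤ a i) (x : E) : 0 ≤ bumpSum I y ρ a x :=
  Finset.sum_nonneg fun i hi => mul_nonneg (ha i hi) (scaledBump_nonneg _ _ _)

theorem bumpSum_eq_zero (hρ : ∀ i ∈ I, 0 < ρ i) {x : E}
    (hx : ∀ i ∈ I, x ∉ closedBall (y i) (ρ i)) : bumpSum I y ρ a x = 0 :=
  Finset.sum_eq_zero fun i hi => by rw [scaledBump_eq_zero (hρ i hi) (hx i hi), smul_zero]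

theorem le_bumpSum (hρ : ∀ i ∈ I, 0 < ρ i) (ha : ∀ i ∈ I, 0 ≤ a i) {i : ι} (hi : i ∈ I) {x : E}
    (hx : x ∈ closedBall (y i) (ρ i / 2)) : a i ≤ bumpSum I y ρ a x := by
  have h := Finset.single_le_sum (f := fun j => a j • scaledBump (y j) (ρ j) x)
    (fun j hj => mul_nonneg (ha j hj) (scaledBump_nonneg _ _ _)) hi
  rwa [scaledBump_eq_one (hρ i hi) hx, smul_eq_mul, mul_one] at h

theorem iteratedFDeriv_bumpSum (k : ℕ) (x : E) :
    iteratedFDeriv ℝ k (bumpSum I y ρ a) x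
      = ∑ i ∈ I, a i • iteratedFDeriv ℝ k (scaledBump (y i) (ρ i)) x := by
  have hk : ((k : ℕ∞) : WithTop ℕ∞) ≤ ((⊤ : ℕ∞) : WithTop ℕ∞) := by exact_mod_cast le_top
  have hb (i : ι) : ContDiff ℝ k (scaledBump (y i) (ρ i)) := (contDiff_scaledBump _ _).of_le hk
  unfold bumpSum
  rw [iteratedFDeriv_fun_sum_apply fun i _ => ((hb i).const_smul (a i)).contDiffAt]
  exact Finset.sum_congr rfl fun i _ => iteratedFDeriv_const_smul_apply' (hb i).contDiffAt

theorem norm_iteratedFDeriv_bumpSum_rpow_le {p M : ℝ} (hp : 0 < p) (hM : 0 ≤ M) {s k : ℕ}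
    (hks : k ≤ s)
    (hbound : ∀ k ≤ s, ∀ (y : E) (ρ : ℝ), 0 < ρ → ∀ x,
      ‖iteratedFDeriv ℝ k (scaledBump y ρ) x‖ ≤ M * ρ⁻¹ ^ k)
    (hρ : ∀ i ∈ I, 0 < ρ i) (ha : ∀ i ∈ I, 0 ≤ a i)
    (hdisj : (I : Set ι).PairwiseDisjoint fun i => closedBall (y i) (ρ i)) (x : E) :
    ‖iteratedFDeriv ℝ k (bumpSum I y ρ a) x‖ ^ p
      ≤ ∑ i ∈ I, (closedBall (y i) (ρ i)).indicator
          (fun _ => (a i * (M * (ρ i)⁻¹ ^ k)) ^ p) x := by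
  rw [iteratedFDeriv_bumpSum]
  have hnn (i : ι) (hi : i ∈ I) : 0 ≤ (closedBall (y i) (ρ i)).indicator
      (fun _ => (a i * (M * (ρ i)⁻¹ ^ k)) ^ p) x :=
    Set.indicator_nonneg (fun _ _ => Real.rpow_nonneg (mul_nonneg (ha i hi)
      (mul_nonneg hM (pow_nonneg (inv_nonneg.2 (hρ i hi).le) _))) _) _
  by_cases h : ∃ j ∈ I, x ∈ closedBall (y j) (ρ j)
  · obtain ⟨j, hj, hxj⟩ := h
    rw [Finset.sum_eq_single_of_mem j hj]
    · refine le_trans ?_ (Finset.single_le_sum hnn hj)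
      rw [Set.indicator_of_mem hxj, norm_smul, Real.norm_of_nonneg (ha j hj)]
      have haj := ha j hj
      gcongr
      exact hbound k hks _ _ (hρ j hj) x
    · intro i hi hij
      have hxi : x ∉ closedBall (y i) (ρ i) := fun hxi =>
        Set.disjoint_left.1 (hdisj hi hj hij) hxi hxj
      rw [iteratedFDeriv_scaledBump_eq_zero (hρ i hi) hxi, smul_zero]
  · push Not at h
    rw [Finset.sum_eq_zero fun i hi => by
      rw [iteratedFDeriv_scaledBump_eq_zero (hρ i hi) (h i hi), smul_zero], norm_zero,
      Real.zero_rpow hp.ne']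
    exact Finset.sum_nonneg hnn

theorem inv_pow_le_mul_inv_pow {r δ : ℝ} (hr : 0 < r) (hrδ : r ≤ δ) {k s : ℕ} (hks : k ≤ s) :
    r⁻¹ ^ k ≤ max 1 δ ^ s * r⁻¹ ^ s := by
  have h1 : r ^ (s - k) ≤ max 1 δ ^ s :=
    (pow_le_pow_left₀ hr.le (hrδ.trans (le_max_right _ _)) _).trans
      (pow_le_pow_right₀ (le_max_left _ _) (Nat.sub_le _ _))
  calc r⁻¹ ^ k = r ^ (s - k) * r⁻¹ ^ s := by
        rw [← Nat.sub_add_cancel hks]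
        simp only [Nat.add_sub_cancel, pow_add, ← mul_assoc, ← mul_pow, mul_inv_cancel₀ hr.ne']
        simp
    _ ≤ _ := by gcongr

variable [MeasurableSpace E] [BorelSpace E] (μ : Measure E) [μ.IsAddHaarMeasure]

/-- The Sobolev norm of a sum of disjointly supported scaled bumps is controlled by the sum of the
contributions of the individual bumps. -/
theorem exists_sum_integral_iteratedFDeriv_bumpSum_le (ι : Type*) {p : ℝ} (hp : 0 < p)
    (s : ℕ) (δ : ℝ) :
    ∃ C : ℝ, 0 < C ∧ ∀ (I : Finset ι) (y : ι → E) (ρ a : ι → ℝ),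
      (∀ i ∈ I, 0 < ρ i) → (∀ i ∈ I, ρ i ≤ δ) → (∀ i ∈ I, 0 ≤ a i) →
      (I : Set ι).PairwiseDisjoint (fun i => closedBall (y i) (ρ i)) →
      ∑ k ∈ Finset.range (s + 1), ∫ x, ‖iteratedFDeriv ℝ k (bumpSum I y ρ a) x‖ ^ p ∂μ
        ≤ C * ∑ i ∈ I, a i ^ p * ρ i ^ ((Module.finrank ℝ E : ℝ) - s * p) := by
  obtain ⟨M, hM, hbound⟩ := exists_norm_iteratedFDeriv_scaledBump_le E s
  set V := μ.real (ball (0 : E) 1)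
  have hV : 0 < V := ENNReal.toReal_pos (measure_ball_pos μ _ one_pos).ne' measure_ball_lt_top.ne
  set T := max 1 δ ^ s
  have hT : 0 < T := by positivity
  refine ⟨(s + 1) * ((M * T) ^ p * V), by positivity, fun I y ρ a hρ hρδ ha hdisj => ?_⟩
  have key (k : ℕ) (hk : k ∈ Finset.range (s + 1)) :
      ∫ x, ‖iteratedFDeriv ℝ k (bumpSum I y ρ a) x‖ ^ p ∂μ
        ≤ (M * T) ^ p * V * ∑ i ∈ I, a i ^ p * ρ i ^ ((Module.finrank ℝ E : ℝ) - s * p) := by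
    have hks : k ≤ s := Nat.lt_succ_iff.1 (Finset.mem_range.1 hk)
    have hint (i : ι) : Integrable ((closedBall (y i) (ρ i)).indicator
        (fun _ => (a i * (M * (ρ i)⁻¹ ^ k)) ^ p)) μ :=
      (integrable_indicator_iff measurableSet_closedBall).2
        (integrableOn_const measure_closedBall_lt_top.ne)
    refine (integral_mono_of_nonneg (Filter.Eventually.of_forall fun x => by positivity)
      (integrable_finsetSum I fun i _ => hint i) (Filter.Eventually.of_forall fun x =>
      norm_iteratedFDeriv_bumpSum_rpow_le hp hM.le hks hbound hρ ha hdisj x)).trans ?_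
    rw [integral_finsetSum I fun i _ => hint i, Finset.mul_sum]
    refine Finset.sum_le_sum fun i hi => ?_
    have hρi := hρ i hi
    rw [integral_indicator measurableSet_closedBall, setIntegral_const, smul_eq_mul,
      Measure.addHaar_real_closedBall μ _ hρi.le]
    calc ρ i ^ Module.finrank ℝ E * V * (a i * (M * (ρ i)⁻¹ ^ k)) ^ p
        ≤ ρ i ^ Module.finrank ℝ E * V * (a i * (M * (T * (ρ i)⁻¹ ^ s))) ^ p := by
          have := ha i hi
          gcongr
          exact inv_pow_le_mul_inv_pow hρi (hρδ i hi) hks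
      _ = _ := by
          have h1 : a i * (M * (T * (ρ i)⁻¹ ^ s)) = (M * T) * a i * (ρ i)⁻¹ ^ s := by ring
          have h2 : ((ρ i)⁻¹ ^ s) ^ p = ρ i ^ (-(s * p)) := by
            rw [← Real.rpow_natCast, ← Real.rpow_mul (by positivity), Real.inv_rpow hρi.le,
              Real.rpow_neg hρi.le]
          rw [h1, Real.mul_rpow (mul_nonneg (by positivity) (ha i hi)) (by positivity),
            Real.mul_rpow (by positivity) (ha i hi), h2, sub_eq_add_neg, Real.rpow_add hρi,
            Real.rpow_natCast]
          ring
  refine (Finset.sum_le_sum key).trans_eq ?_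
  rw [Finset.sum_const, Finset.card_range, nsmul_eq_mul]
  push_cast
  ring

end Bump

section Whitney

variable {E : Type*} [NormedAddCommGroup E] [NormedSpace ℝ E]

/-- The point obtained from `x` by moving towards the origin by at most `infDist x P / 4`. -/
noncomputable def shiftedCenter (P : Set E) (δ : ℝ) (x : E) : E :=
  (1 - infDist x P / (4 * δ)) • x

variable {P : Set E} {δ : ℝ} {x z : E}

omit [NormedSpace ℝ E] in
theorem infDist_le_two_mul (hP : P.Nonempty) (hPδ : P ⊆ ball 0 δ) (hx : x ∈ ball (0 : E) δ) :
    infDist x P ≤ 2 * δ := by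
  obtain ⟨y, hy⟩ := hP
  have h1 := infDist_le_dist_of_mem (x := x) hy
  have h2 := dist_triangle_right x y 0
  have h3 := mem_ball.1 (hPδ hy)
  have h4 := mem_ball.1 hx
  linarith

theorem mem_closedBall_shiftedCenter (hδ : 0 < δ) (hx : x ∈ ball (0 : E) δ) :
    x ∈ closedBall (shiftedCenter P δ x) (infDist x P / 4) := by
  have h0 : 0 ≤ infDist x P := infDist_nonneg
  have h1 : x - shiftedCenter P δ x = (infDist x P / (4 * δ)) • x := by
    rw [shiftedCenter, sub_smul, one_smul, sub_sub_cancel]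
  rw [mem_closedBall_iff_norm, h1, norm_smul, Real.norm_of_nonneg (by positivity)]
  have h2 : ‖x‖ ≤ δ := (mem_ball_zero_iff.1 hx).le
  calc infDist x P / (4 * δ) * ‖x‖ ≤ infDist x P / (4 * δ) * δ := by gcongr
    _ = infDist x P / 4 := by field_simp

theorem closedBall_shiftedCenter_subset (hδ : 0 < δ) (hP : P.Nonempty) (hPδ : P ⊆ ball 0 δ)
    (hx : x ∈ ball (0 : E) δ) :
    closedBall (shiftedCenter P δ x) (infDist x P / 4) ⊆ ball 0 δ := by
  have h0 : 0 ≤ infDist x P := infDist_nonneg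
  have h1 := infDist_le_two_mul hP hPδ hx
  have h2 : 0 < 1 - infDist x P / (4 * δ) := by
    rw [sub_pos, div_lt_one (by positivity)]
    linarith
  refine closedBall_subset_ball' ?_
  rw [dist_zero_right, shiftedCenter, norm_smul, Real.norm_of_nonneg h2.le]
  have h3 : (1 - infDist x P / (4 * δ)) * ‖x‖ < (1 - infDist x P / (4 * δ)) * δ :=
    mul_lt_mul_of_pos_left (mem_ball_zero_iff.1 hx) h2
  have h4 : (1 - infDist x P / (4 * δ)) * δ = δ - infDist x P / 4 := by field_simp
  linarith

theorem notMem_closedBall_shiftedCenter (hδ : 0 < δ) (hx : x ∈ ball (0 : E) δ)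
    (hpos : 0 < infDist x P) (hz : z ∈ P) :
    z ∉ closedBall (shiftedCenter P δ x) (infDist x P / 4) := by
  intro h
  have h1 := infDist_le_dist_of_mem (x := x) hz
  have h2 := dist_triangle_right x z (shiftedCenter P δ x)
  have h3 := mem_closedBall.1 h
  have h4 := mem_closedBall.1 (mem_closedBall_shiftedCenter (P := P) hδ hx)
  linarith

theorem infDist_le_of_mem_closedBall_shiftedCenter (hδ : 0 < δ) (hx : x ∈ ball (0 : E) δ)
    (hz : z ∈ closedBall (shiftedCenter P δ x) (5 * (infDist x P / 4))) :
    infDist z P ≤ 10 * (infDist x P / 4) := by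
  have h1 := infDist_le_infDist_add_dist (s := P) (x := z) (y := x)
  have h2 := dist_triangle_right z x (shiftedCenter P δ x)
  have h3 := mem_closedBall.1 hz
  have h4 := mem_closedBall.1 (mem_closedBall_shiftedCenter (P := P) hδ hx)
  linarith

variable [FiniteDimensional ℝ E] [MeasurableSpace E] [BorelSpace E]
  (μ : Measure E) [μ.IsAddHaarMeasure]

/-- Finitely many disjoint balls in the complement of `P` capture a fixed proportion of the
integral of `infDist · P ^ γ`. -/
theorem exists_finset_lintegral_infDist_le {γ : ℝ} (hγ : 0 < γ) :
    ∃ K : ℝ, 0 < K ∧ ∀ (δ : ℝ) (P : Set E), 0 < δ → P.Nonempty → P ⊆ ball 0 δ →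
      ∃ I : Finset E, (∀ i ∈ I, i ∈ ball 0 δ ∧ 0 < infDist i P) ∧
        (I : Set E).PairwiseDisjoint
          (fun i => closedBall (shiftedCenter P δ i) (infDist i P / 4)) ∧
        ∫⁻ x in ball 0 δ, ‖infDist x P‖ₑ ^ γ ∂μ
          ≤ ENNReal.ofReal (K * ∑ i ∈ I, (infDist i P / 4) ^ (γ + Module.finrank ℝ E)) := by
  set n := Module.finrank ℝ E
  set V := μ.real (ball (0 : E) 1)
  have hV : 0 < V := ENNReal.toReal_pos (measure_ball_pos μ _ one_pos).ne' measure_ball_lt_top.ne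
  set K : ℝ := 10 ^ γ * (5 ^ n * V)
  have hK : 0 < K := by positivity
  refine ⟨2 * K, by positivity, fun δ P hδ hP hPδ => ?_⟩
  set L := ∫⁻ x in ball 0 δ, ‖infDist x P‖ₑ ^ γ ∂μ with hL
  rcases eq_or_ne L 0 with hL0 | hL0
  · exact ⟨∅, by simp, by simp, by simp [hL0]⟩
  have hLtop : L ≠ ⊤ := by
    refine ((setLIntegral_mono (g := fun _ => ENNReal.ofReal (2 * δ) ^ γ) measurable_const
      fun x hx => ?_).trans_lt ?_).ne
    · gcongr
      rw [Real.enorm_of_nonneg infDist_nonneg]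
      exact ENNReal.ofReal_le_ofReal (infDist_le_two_mul hP hPδ hx)
    · rw [setLIntegral_const]
      exact ENNReal.mul_lt_top (ENNReal.rpow_lt_top_of_nonneg hγ.le ENNReal.ofReal_ne_top)
        measure_ball_lt_top
  obtain ⟨u, hut, hdisj, hcov⟩ := Vitali.exists_disjoint_subfamily_covering_enlargement_closedBall
    {x : E | x ∈ ball 0 δ ∧ 0 < infDist x P} (shiftedCenter P δ) (fun x => infDist x P / 4) δ
    (fun x hx => by have := infDist_le_two_mul hP hPδ hx.1; linarith) 5 (by norm_num)
  have hucount : Countable u := (hdisj.countable_of_nonempty_interior fun i hi =>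
    (nonempty_ball.2 (by have := (hut hi).2; positivity)).mono ball_subset_interior_closedBall)
  have hball (i : u) : ∫⁻ x in closedBall (shiftedCenter P δ i) (5 * (infDist (i : E) P / 4)),
      ‖infDist x P‖ₑ ^ γ ∂μ ≤ ENNReal.ofReal (K * (infDist (i : E) P / 4) ^ (γ + n)) := by
    have hi := hut i.2
    set r := infDist (i : E) P / 4
    have hr : 0 < r := div_pos hi.2 (by norm_num)
    refine (setLIntegral_mono (g := fun _ => ENNReal.ofReal (10 * r) ^ γ) measurable_const
      fun x hx => ?_).trans_eq ?_
    · gcongr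
      rw [Real.enorm_of_nonneg infDist_nonneg]
      exact ENNReal.ofReal_le_ofReal (infDist_le_of_mem_closedBall_shiftedCenter hδ hi.1 hx)
    · rw [setLIntegral_const, ENNReal.ofReal_rpow_of_pos (by positivity),
        ← ofReal_measureReal measure_closedBall_lt_top.ne,
        Measure.addHaar_real_closedBall μ _ (by positivity),
        ← ENNReal.ofReal_mul (by positivity), Real.mul_rpow (by norm_num) hr.le,
        Real.rpow_add hr, Real.rpow_natCast, mul_pow]
      congr 1
      ring
  have hLle : L ≤ ∑' i : u, ENNReal.ofReal (K * (infDist (i : E) P / 4) ^ (γ + n)) := by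
    calc L ≤ ∫⁻ x in ⋃ i : u, closedBall (shiftedCenter P δ i) (5 * (infDist (i : E) P / 4)),
          ‖infDist x P‖ₑ ^ γ ∂μ := by
          rw [hL, ← lintegral_indicator measurableSet_ball,
            ← lintegral_indicator (MeasurableSet.iUnion fun _ => measurableSet_closedBall)]
          refine lintegral_mono fun x => ?_
          by_cases hx : x ∈ ball 0 δ
          · rcases infDist_nonneg.eq_or_lt (a := (0 : ℝ)) (b := infDist x P) with h0 | h0
            · rw [Set.indicator_of_mem hx, ← h0, enorm_zero, ENNReal.zero_rpow_of_pos hγ]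
              exact zero_le
            · obtain ⟨b, hb, hsub⟩ := hcov x ⟨hx, h0⟩
              rw [Set.indicator_of_mem hx, Set.indicator_of_mem (Set.mem_iUnion.2 ⟨⟨b, hb⟩,
                hsub (mem_closedBall_shiftedCenter hδ hx)⟩)]
          · simp [hx]
      _ ≤ ∑' i : u, ∫⁻ x in closedBall (shiftedCenter P δ i) (5 * (infDist (i : E) P / 4)),
          ‖infDist x P‖ₑ ^ γ ∂μ := lintegral_iUnion_le _ _
      _ ≤ _ := ENNReal.tsum_le_tsum hball
  have hlt := (ENNReal.half_lt_self hL0 hLtop).trans_le hLle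
  rw [ENNReal.tsum_eq_iSup_sum, lt_iSup_iff] at hlt
  obtain ⟨F, hF⟩ := hlt
  have hmem (i : E) (hi : i ∈ F.map (Function.Embedding.subtype _)) : i ∈ u := by
    obtain ⟨j, -, rfl⟩ := Finset.mem_map.1 hi
    exact j.2
  refine ⟨F.map (Function.Embedding.subtype _), fun i hi => hut (hmem i hi),
    hdisj.subset fun i hi => hmem i hi, ?_⟩
  rw [ENNReal.div_lt_iff (by simp) (by simp), ← ENNReal.ofReal_sum_of_nonneg fun i _ => by
      have : 0 ≤ infDist (i : E) P := infDist_nonneg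
      positivity, ← Finset.mul_sum, ← ENNReal.ofReal_ofNat, ← ENNReal.ofReal_mul' (by simp)] at hF
  refine hF.le.trans_eq ?_
  rw [Finset.sum_map]
  congr 1
  simp only [Function.Embedding.subtype_apply]
  ring

omit [MeasurableSpace E] [BorelSpace E] in
theorem support_bumpSum_shiftedCenter_subset (hδ : 0 < δ) (hP : P.Nonempty) (hPδ : P ⊆ ball 0 δ)
    {I : Finset E} (hI : ∀ i ∈ I, i ∈ ball 0 δ ∧ 0 < infDist i P) (a : E → ℝ) :
    Function.support (bumpSum I (shiftedCenter P δ) (fun i => infDist i P / 4) a) ⊆ ball 0 δ := by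
  intro x hx
  by_contra h
  exact hx (bumpSum_eq_zero (fun i hi => div_pos (hI i hi).2 (by norm_num)) fun i hi hxi =>
    h (closedBall_shiftedCenter_subset hδ hP hPδ (hI i hi).1 hxi))

omit [MeasurableSpace E] [BorelSpace E] in
theorem bumpSum_shiftedCenter_eq_zero (hδ : 0 < δ)
    {I : Finset E} (hI : ∀ i ∈ I, i ∈ ball 0 δ ∧ 0 < infDist i P) (a : E → ℝ) (hx : x ∈ P) :
    bumpSum I (shiftedCenter P δ) (fun i => infDist i P / 4) a x = 0 :=
  bumpSum_eq_zero (fun i hi => div_pos (hI i hi).2 (by norm_num)) fun i hi =>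
    notMem_closedBall_shiftedCenter hδ (hI i hi).1 (hI i hi).2 hx

end Whitney

section LowerBound

variable {E : Type*} [NormedAddCommGroup E] [NormedSpace ℝ E] [FiniteDimensional ℝ E]
  [MeasurableSpace E] [BorelSpace E] (μ : Measure E) [μ.IsAddHaarMeasure]
  {ι : Type*} {I : Finset ι} {y : ι → E} {ρ a : ι → ℝ} {B : Set E} {q : ENNReal}

theorem ofReal_sum_rpow_le_eLpNorm_bumpSum (hq : q ≠ 0) (hq_top : q ≠ ⊤)
    (hρ : ∀ i ∈ I, 0 < ρ i) (ha : ∀ i ∈ I, 0 ≤ a i)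
    (hdisj : (I : Set ι).PairwiseDisjoint fun i => closedBall (y i) (ρ i))
    (hB : ∀ i ∈ I, closedBall (y i) (ρ i) ⊆ B) :
    ENNReal.ofReal ((∑ i ∈ I, a i ^ q.toReal *
        ((ρ i / 2) ^ Module.finrank ℝ E * μ.real (ball 0 1))) ^ (1 / q.toReal))
      ≤ eLpNorm (bumpSum I y ρ a) q (μ.restrict B) := by
  have hq' : 0 < q.toReal := ENNReal.toReal_pos hq hq_top
  have hnn (i : ι) (hi : i ∈ I) :
      0 ≤ a i ^ q.toReal * ((ρ i / 2) ^ Module.finrank ℝ E * μ.real (ball 0 1)) := by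
    have := ha i hi
    have := hρ i hi
    positivity
  have hsub (i : ι) (hi : i ∈ I) : closedBall (y i) (ρ i / 2) ⊆ closedBall (y i) (ρ i) :=
    closedBall_subset_closedBall (by have := hρ i hi; linarith)
  rw [eLpNorm_eq_lintegral_rpow_enorm_toReal hq hq_top,
    ← ENNReal.ofReal_rpow_of_nonneg (Finset.sum_nonneg hnn) (by positivity)]
  gcongr
  calc _ = ∑ i ∈ I, ∫⁻ x in closedBall (y i) (ρ i / 2), ENNReal.ofReal (a i) ^ q.toReal ∂μ := by
        rw [ENNReal.ofReal_sum_of_nonneg hnn]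
        refine Finset.sum_congr rfl fun i hi => ?_
        have := hρ i hi
        rw [setLIntegral_const, ENNReal.ofReal_rpow_of_nonneg (ha i hi) hq'.le,
          ← ofReal_measureReal measure_closedBall_lt_top.ne,
          Measure.addHaar_real_closedBall μ _ (by positivity),
          ← ENNReal.ofReal_mul (Real.rpow_nonneg (ha i hi) _)]
    _ ≤ ∑ i ∈ I, ∫⁻ x in closedBall (y i) (ρ i / 2), ‖bumpSum I y ρ a x‖ₑ ^ q.toReal ∂μ := by
        refine Finset.sum_le_sum fun i hi => setLIntegral_mono' measurableSet_closedBall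
          fun x hx => ?_
        rw [Real.enorm_of_nonneg (bumpSum_nonneg ha x)]
        gcongr
        exact le_bumpSum hρ ha hi hx
    _ = ∫⁻ x in ⋃ i ∈ I, closedBall (y i) (ρ i / 2), ‖bumpSum I y ρ a x‖ₑ ^ q.toReal ∂μ :=
        (lintegral_biUnion_finset (hdisj.mono_on hsub)
          (fun _ _ => measurableSet_closedBall) _).symm
    _ ≤ _ := lintegral_mono_set (Set.iUnion₂_subset fun i hi => (hsub i hi).trans (hB i hi))

theorem ofReal_mul_rpow_le_eLpNorm_bumpSum (hq : q ≠ 0) (hρ : ∀ i ∈ I, 0 < ρ i)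
    (ha : ∀ i ∈ I, 0 ≤ a i) {i : ι} (hi : i ∈ I) (hB : closedBall (y i) (ρ i) ⊆ B) :
    ENNReal.ofReal (a i * ((ρ i / 2) ^ Module.finrank ℝ E * μ.real (ball 0 1)) ^ (1 / q.toReal))
      ≤ eLpNorm (bumpSum I y ρ a) q (μ.restrict B) := by
  have hρi := hρ i hi
  have hμ : (μ.restrict B) (closedBall (y i) (ρ i / 2))
      = ENNReal.ofReal ((ρ i / 2) ^ Module.finrank ℝ E * μ.real (ball 0 1)) := by
    rw [Measure.restrict_eq_self _ ((closedBall_subset_closedBall (by linarith)).trans hB),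
      ← ofReal_measureReal measure_closedBall_lt_top.ne,
      Measure.addHaar_real_closedBall μ _ (by positivity)]
  have hV : 0 < μ.real (ball (0 : E) 1) :=
    ENNReal.toReal_pos (measure_ball_pos μ _ one_pos).ne' measure_ball_lt_top.ne
  calc _ = eLpNorm ((closedBall (y i) (ρ i / 2)).indicator fun _ => a i) q (μ.restrict B) := by
        rw [eLpNorm_indicator_const' measurableSet_closedBall _ hq, hμ,
          Real.enorm_of_nonneg (ha i hi), ENNReal.ofReal_rpow_of_nonneg (by positivity)
          (by positivity), ENNReal.ofReal_mul (ha i hi)]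
        rw [hμ]
        exact (ENNReal.ofReal_pos.2 (by positivity)).ne'
    _ ≤ _ := by
        refine eLpNorm_mono_real fun x => ?_
        by_cases hx : x ∈ closedBall (y i) (ρ i / 2)
        · rw [Set.indicator_of_mem hx, Real.norm_of_nonneg (ha i hi)]
          exact le_bumpSum hρ ha hi hx
        · rw [Set.indicator_of_notMem hx, norm_zero]
          exact bumpSum_nonneg ha x

end LowerBound

section Fooling

variable {E : Type*} [NormedAddCommGroup E] [NormedSpace ℝ E] [FiniteDimensional ℝ E]
  [MeasurableSpace E] [BorelSpace E] (μ : Measure E) [μ.IsAddHaarMeasure]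

/-- `f` is smooth, nonnegative, supported in the ball of radius `δ`, vanishes on `P`, and has
Sobolev norm at most one. -/
structure IsFooling (p : ℝ) (s : ℕ) (δ : ℝ) (P : Set E) (f : E → ℝ) : Prop where
  contDiff : ContDiff ℝ (⊤ : ℕ∞) f
  nonneg : ∀ x, 0 ≤ f x
  support_subset : Function.support f ⊆ ball 0 δ
  eq_zero : ∀ x ∈ P, f x = 0
  norm_le : (∑ k ∈ Finset.range (s + 1), ∫ x, ‖iteratedFDeriv ℝ k f x‖ ^ p ∂μ) ^ (1 / p) ≤ 1

/-- A sum of bumps on disjoint balls centered at shifted points is a fooling function as soon as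
its coefficients satisfy a summability condition. -/
theorem exists_isFooling_bumpSum {p : ℝ} (hp : 0 < p) (s : ℕ) {δ : ℝ} (hδ : 0 < δ) :
    ∃ C : ℝ, 0 < C ∧ ∀ P : Set E, P.Nonempty → P ⊆ ball 0 δ → ∀ I : Finset E,
      (∀ i ∈ I, i ∈ ball 0 δ ∧ 0 < infDist i P) →
      (I : Set E).PairwiseDisjoint
        (fun i => closedBall (shiftedCenter P δ i) (infDist i P / 4)) →
      ∀ a : E → ℝ, (∀ i ∈ I, 0 ≤ a i) →
      C * ∑ i ∈ I, a i ^ p * (infDist i P / 4) ^ ((Module.finrank ℝ E : ℝ) - s * p) ≤ 1 →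
      IsFooling μ p s δ P (bumpSum I (shiftedCenter P δ) (fun i => infDist i P / 4) a) := by
  obtain ⟨C, hC, hsum⟩ := exists_sum_integral_iteratedFDeriv_bumpSum_le μ E hp s δ
  refine ⟨C, hC, fun P hP hPδ I hI hdisj a ha hle =>
    ⟨contDiff_bumpSum _ _ _ _, bumpSum_nonneg ha,
      support_bumpSum_shiftedCenter_subset hδ hP hPδ hI a,
      fun x hx => bumpSum_shiftedCenter_eq_zero hδ hI a hx, ?_⟩⟩
  refine Real.rpow_le_one (Finset.sum_nonneg fun k _ => integral_nonneg fun x => by positivity)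
    ((hsum I _ _ a (fun i hi => div_pos (hI i hi).2 (by norm_num)) (fun i hi => ?_) ha
      hdisj).trans hle) (by positivity)
  have := infDist_le_two_mul hP hPδ (hI i hi).1
  linarith

theorem exists_isFooling_of_lt {p : ℝ} (hp : 0 < p) {s : ℕ} (hs : 0 < s) {q : ENNReal}
    (hq : 1 ≤ q) (hqp : q < ENNReal.ofReal p) {δ : ℝ} (hδ : 0 < δ) :
    ∃ c : ℝ, 0 < c ∧ ∀ P : Set E, P.Nonempty → P ⊆ ball 0 δ → ∃ f : E → ℝ,
      IsFooling μ p s δ P f ∧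
        ENNReal.ofReal c * (eLpNorm (fun x => infDist x P)
            (ENNReal.ofReal ((s : ℝ) / (1 / q.toReal - 1 / p))) (μ.restrict (ball 0 δ))) ^ (s : ℝ)
          ≤ eLpNorm f q (μ.restrict (ball 0 δ)) := by
  have hq0 : q ≠ 0 := (zero_lt_one.trans_le hq).ne'
  have hqt : q ≠ ⊤ := hqp.ne_top
  set r := q.toReal with hr_def
  have hr : 0 < r := ENNReal.toReal_pos hq0 hqt
  have hrp : r < p := ENNReal.toReal_lt_of_lt_ofReal hqp
  set e := 1 / r - 1 / p with he_def
  have he : 0 < e := sub_pos.2 (one_div_lt_one_div_of_lt hr hrp)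
  have hs' : (0 : ℝ) < s := by exact_mod_cast hs
  set γ := (s : ℝ) / e with hγ_def
  have hγ : 0 < γ := by positivity
  obtain ⟨C, hC, hfool⟩ := exists_isFooling_bumpSum (E := E) μ hp s hδ
  obtain ⟨K, hK, hcov⟩ := exists_finset_lintegral_infDist_le (E := E) μ hγ
  set n := Module.finrank ℝ E
  set V := μ.real (ball (0 : E) 1)
  have hV : 0 < V := ENNReal.toReal_pos (measure_ball_pos μ _ one_pos).ne' measure_ball_lt_top.ne
  set W := V / 2 ^ n with hW_def
  have hW : 0 < W := by positivity
  refine ⟨C ^ (-(1 / p)) * W ^ (1 / r) * K ^ (-e), by positivity, fun P hP hPδ => ?_⟩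
  obtain ⟨I, hI, hdisj, hL⟩ := hcov δ P hδ hP hPδ
  have hρ (i : E) (hi : i ∈ I) : 0 < infDist i P / 4 := div_pos (hI i hi).2 (by norm_num)
  set S := ∑ i ∈ I, (infDist i P / 4) ^ (γ + n) with hS_def
  have hS : 0 ≤ S := Finset.sum_nonneg fun i hi => (Real.rpow_pos_of_pos (hρ i hi) _).le
  set A := (C * S) ^ (-(1 / p)) with hA_def
  have hA : 0 ≤ A := by positivity
  have hAS : C * (A ^ p * S) ≤ 1 := by
    rcases hS.eq_or_lt with h | h
    · rw [← h]; simp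
    · rw [hA_def, ← Real.rpow_mul (by positivity), neg_mul, one_div_mul_cancel hp.ne',
        Real.rpow_neg_one]
      field_simp
      rfl
  set a : E → ℝ := fun i => A * (infDist i P / 4) ^ (s + γ / p) with ha_def
  have ha (i : E) (hi : i ∈ I) : 0 ≤ a i := mul_nonneg hA (Real.rpow_pos_of_pos (hρ i hi) _).le
  refine ⟨_, hfool P hP hPδ I hI hdisj a ha ?_, ?_⟩
  · refine le_of_eq_of_le ?_ hAS
    rw [hS_def, Finset.mul_sum (a := A ^ p)]
    congr 1
    refine Finset.sum_congr rfl fun i hi => ?_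
    have := hρ i hi
    rw [ha_def]
    dsimp only
    rw [Real.mul_rpow hA (by positivity), ← Real.rpow_mul this.le, mul_assoc,
      ← Real.rpow_add this]
    congr 2
    field_simp
    ring
  · refine le_trans ?_ (ofReal_sum_rpow_le_eLpNorm_bumpSum μ hq0 hqt hρ ha hdisj fun i hi =>
      closedBall_shiftedCenter_subset hδ hP hPδ (hI i hi).1)
    have hsum : ∑ i ∈ I, a i ^ r * ((infDist i P / 4 / 2) ^ n * V) = A ^ r * (W * S) := by
      rw [hS_def, Finset.mul_sum, Finset.mul_sum]
      refine Finset.sum_congr rfl fun i hi => ?_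
      have := hρ i hi
      have hexp : (s + γ / p) * r = γ := by
        have hse : (s : ℝ) = γ * e := by rw [hγ_def]; field_simp
        rw [hse, he_def]
        field_simp
        ring
      rw [ha_def]
      dsimp only
      rw [Real.mul_rpow hA (by positivity), ← Real.rpow_mul this.le, hexp, Real.rpow_add this,
        Real.rpow_natCast, div_pow, hW_def]
      ring
    have hnorm : eLpNorm (fun x => infDist x P) (ENNReal.ofReal γ) (μ.restrict (ball 0 δ))
        ^ (s : ℝ) ≤ ENNReal.ofReal ((K * S) ^ e) := by
      rw [eLpNorm_eq_lintegral_rpow_enorm_toReal (ENNReal.ofReal_pos.2 hγ).ne'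
        ENNReal.ofReal_ne_top, ENNReal.toReal_ofReal hγ.le, ← ENNReal.rpow_mul,
        ← ENNReal.ofReal_rpow_of_nonneg (by positivity) he.le]
      have : 1 / γ * s = e := by rw [hγ_def]; field_simp
      rw [this]
      gcongr
    rw [hsum]
    refine (mul_le_mul_right hnorm _).trans ?_
    rw [← ENNReal.ofReal_mul (by positivity)]
    refine ENNReal.ofReal_le_ofReal ?_
    rcases hS.eq_or_lt with h | h
    · rw [← h, mul_zero, Real.zero_rpow he.ne', mul_zero]
      positivity
    · have h1 : (A ^ r) ^ (1 / r) = A := by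
        rw [← Real.rpow_mul hA, mul_one_div_cancel hr.ne', Real.rpow_one]
      have h2 : S ^ e = S ^ (1 / r) * S ^ (-(1 / p)) := by
        rw [← Real.rpow_add h, he_def, sub_eq_add_neg]
      have h3 : K ^ (-e) * K ^ e = 1 := by
        rw [← Real.rpow_add hK, neg_add_cancel, Real.rpow_zero]
      rw [← hr_def, Real.mul_rpow (x := A ^ r) (by positivity) (by positivity), h1, hA_def,
        Real.mul_rpow hC.le h.le, Real.mul_rpow hW.le h.le, Real.mul_rpow hK.le h.le, h2]
      refine le_of_eq ?_
      linear_combination (C ^ (-(1 / p)) * W ^ (1 / r) * S ^ (1 / r) * S ^ (-(1 / p))) * h3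

theorem exists_isFooling_eLpNorm_top {p : ℝ} (hp : 0 < p) {s : ℕ} {q : ENNReal} (hq : q ≠ 0)
    (hs : 0 < (s : ℝ) - Module.finrank ℝ E * (1 / p - 1 / q.toReal)) {δ : ℝ} (hδ : 0 < δ) :
    ∃ c : ℝ, 0 < c ∧ ∀ P : Set E, P.Nonempty → P ⊆ ball 0 δ → ∃ f : E → ℝ,
      IsFooling μ p s δ P f ∧
        ENNReal.ofReal c * (eLpNorm (fun x => infDist x P) ⊤ (μ.restrict (ball 0 δ)))
            ^ ((s : ℝ) - Module.finrank ℝ E * (1 / p - 1 / q.toReal))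
          ≤ eLpNorm f q (μ.restrict (ball 0 δ)) := by
  obtain ⟨C, hC, hfool⟩ := exists_isFooling_bumpSum (E := E) μ hp s hδ
  set n := Module.finrank ℝ E
  set r := q.toReal with hr_def
  have hr : 0 ≤ r := ENNReal.toReal_nonneg
  set α := (s : ℝ) - n * (1 / p - 1 / r) with hα_def
  set V := μ.real (ball (0 : E) 1)
  have hV : 0 < V := ENNReal.toReal_pos (measure_ball_pos μ _ one_pos).ne' measure_ball_lt_top.ne
  set W := V / 2 ^ n with hW_def
  have hW : 0 < W := by positivity
  refine ⟨C ^ (-(1 / p)) * W ^ (1 / r) * 8 ^ (-α), by positivity, fun P hP hPδ => ?_⟩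
  set N := eLpNorm (fun x => infDist x P) ⊤ (μ.restrict (ball 0 δ)) with hN_def
  rcases eq_or_ne N 0 with hN0 | hN0
  · refine ⟨_, hfool P hP hPδ ∅ (by simp) (by simp) 0 (by simp) (by simp), ?_⟩
    rw [hN0, ENNReal.zero_rpow_of_pos hs, mul_zero]
    exact zero_le
  have hbound (x : E) (hx : x ∈ ball 0 δ) : ‖infDist x P‖ₑ ≤ ENNReal.ofReal (2 * δ) := by
    rw [Real.enorm_of_nonneg infDist_nonneg]
    exact ENNReal.ofReal_le_ofReal (infDist_le_two_mul hP hPδ hx)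
  have hNtop : N ≠ ⊤ := by
    rw [hN_def, eLpNorm_exponent_top]
    exact ((eLpNormEssSup_le_of_ae_enorm_bound
      (ae_restrict_of_forall_mem measurableSet_ball hbound)).trans_lt ENNReal.ofReal_lt_top).ne
  obtain ⟨x, hx, hxN⟩ : ∃ x ∈ ball (0 : E) δ, N / 2 < ‖infDist x P‖ₑ := by
    by_contra! h
    refine (ENNReal.half_lt_self hN0 hNtop).not_ge ?_
    rw [hN_def, eLpNorm_exponent_top] at h ⊢
    exact eLpNormEssSup_le_of_ae_enorm_bound (ae_restrict_of_forall_mem measurableSet_ball h)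
  set ρ := infDist x P / 4 with hρ_def
  have hxpos : 0 < infDist x P := by
    rw [Real.enorm_of_nonneg infDist_nonneg] at hxN
    exact ENNReal.ofReal_pos.1 ((zero_le).trans_lt hxN)
  have hρ : 0 < ρ := div_pos hxpos (by norm_num)
  have hNle : N ≤ ENNReal.ofReal (8 * ρ) := by
    rw [ENNReal.div_lt_iff (by simp) (by simp), Real.enorm_of_nonneg infDist_nonneg,
      ← ENNReal.ofReal_ofNat, ← ENNReal.ofReal_mul infDist_nonneg] at hxN
    refine hxN.le.trans_eq ?_
    congr 1
    rw [hρ_def]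
    ring
  set A := C ^ (-(1 / p)) * ρ ^ (s - n / p : ℝ) with hA_def
  have hA : 0 ≤ A := by positivity
  refine ⟨_, hfool P hP hPδ {x} (by simpa using ⟨by simpa using hx, hxpos⟩) (by simp)
    (fun _ => A) (fun _ _ => hA) ?_, ?_⟩
  · rw [Finset.sum_singleton, hA_def, Real.mul_rpow (by positivity) (by positivity),
      ← Real.rpow_mul hC.le, ← Real.rpow_mul hρ.le, mul_assoc, ← Real.rpow_add hρ, neg_mul,
      one_div_mul_cancel hp.ne', Real.rpow_neg_one]
    have : (s - n / p : ℝ) * p + (n - s * p) = 0 := by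
      field_simp
      ring
    rw [this, Real.rpow_zero, mul_one, mul_inv_cancel₀ hC.ne']
  · refine le_trans ?_ (ofReal_mul_rpow_le_eLpNorm_bumpSum μ hq (by simpa using hxpos)
      (fun _ _ => hA) (Finset.mem_singleton_self x)
      (closedBall_shiftedCenter_subset hδ hP hPδ hx))
    calc _ ≤ ENNReal.ofReal (C ^ (-(1 / p)) * W ^ (1 / r) * 8 ^ (-α))
          * ENNReal.ofReal (8 * ρ) ^ α := by gcongr
      _ = ENNReal.ofReal (A * ((ρ / 2) ^ n * V) ^ (1 / r)) := by
          rw [ENNReal.ofReal_rpow_of_nonneg (by positivity) hs.le,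
            ← ENNReal.ofReal_mul (by positivity)]
          congr 1
          have h1 : (ρ / 2) ^ n * V = ρ ^ (n : ℝ) * W := by
            rw [Real.rpow_natCast, hW_def, div_pow]
            ring
          have h2 : ρ ^ α = ρ ^ (s - n / p : ℝ) * ρ ^ (n * (1 / r) : ℝ) := by
            rw [← Real.rpow_add hρ, hα_def]
            congr 1
            ring
          have h3 : (8 : ℝ) ^ (-α) * 8 ^ α = 1 := by
            rw [← Real.rpow_add (by norm_num), neg_add_cancel, Real.rpow_zero]
          rw [h1, Real.mul_rpow (by positivity) hW.le, ← Real.rpow_mul hρ.le,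
            Real.mul_rpow (by norm_num) hρ.le, h2, hA_def]
          linear_combination (C ^ (-(1 / p)) * W ^ (1 / r) * ρ ^ (s - n / p : ℝ)
            * ρ ^ (n * (1 / r) : ℝ)) * h3

end Fooling

/-- the fooling function on a Euclidean ball: a smooth nonnegative
function vanishing on `P`, supported in `B`, with Sobolev norm at most one, whose
`L_q(B)`-norm dominates `c · ‖dist(·,P)‖_{L_γ(B)}^α`. -/
theorem fooling_function_on_ball
    (d : ℕ) (hd : 0 < d) (p : ℝ) (hp : 1 < p) (s : ℕ) (hs : (d : ℝ) / p < s)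
    (q : ENNReal) (hq : 1 ≤ q) (γ : ENNReal) (α : ℝ)
    (hγα : (q < ENNReal.ofReal p ∧
              γ = ENNReal.ofReal ((s : ℝ) / (1 / q.toReal - 1 / p)) ∧ α = s) ∨
           (ENNReal.ofReal p ≤ q ∧ γ = ⊤ ∧ α = s - d * (1 / p - 1 / q.toReal)))
    (δ : ℝ) (hδ : 0 < δ) :
    ∃ c : ℝ, 0 < c ∧
      ∀ P : Finset (EuclideanSpace ℝ (Fin d)), P.Nonempty →
        ↑P ⊆ ball (0 : EuclideanSpace ℝ (Fin d)) δ →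
        ∃ f : EuclideanSpace ℝ (Fin d) → ℝ,
          ContDiff ℝ (⊤ : ℕ∞) f ∧
          (∀ x, 0 ≤ f x) ∧
          Function.support f ⊆ ball (0 : EuclideanSpace ℝ (Fin d)) δ ∧
          (∀ x ∈ P, f x = 0) ∧
          (∑ k ∈ Finset.range (s + 1),
              ∫ x, ‖iteratedFDeriv ℝ k f x‖ ^ p) ^ (1 / p) ≤ 1 ∧
          ENNReal.ofReal c *
              (eLpNorm (fun x => infDist x (P : Set (EuclideanSpace ℝ (Fin d)))) γ
                (volume.restrict (ball (0 : EuclideanSpace ℝ (Fin d)) δ))) ^ α ≤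
            eLpNorm f q (volume.restrict (ball (0 : EuclideanSpace ℝ (Fin d)) δ)) := by
  have hd' : (0 : ℝ) < d := by exact_mod_cast hd
  have hs' : 0 < (s : ℝ) := lt_of_le_of_lt (by positivity) hs
  have hfin : Module.finrank ℝ (EuclideanSpace ℝ (Fin d)) = d := finrank_euclideanSpace_fin
  rcases hγα with ⟨hqp, rfl, rfl⟩ | ⟨-, rfl, rfl⟩
  · obtain ⟨c, hc, h⟩ := exists_isFooling_of_lt (E := EuclideanSpace ℝ (Fin d)) volume
      (zero_lt_one.trans hp) (by exact_mod_cast hs') hq hqp hδ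
    refine ⟨c, hc, fun P hP hPδ => ?_⟩
    obtain ⟨f, hf, hle⟩ := h P hP hPδ
    exact ⟨f, hf.contDiff, hf.nonneg, hf.support_subset, hf.eq_zero, hf.norm_le, hle⟩
  · have hα : 0 < (s : ℝ) - d * (1 / p - 1 / q.toReal) := by
      have : 0 ≤ d * (1 / q.toReal) := by positivity
      rw [mul_sub, mul_one_div]
      linarith
    obtain ⟨c, hc, h⟩ := exists_isFooling_eLpNorm_top (E := EuclideanSpace ℝ (Fin d)) volume
      (zero_lt_one.trans hp) (zero_lt_one.trans_le hq).ne' (by rwa [hfin]) hδ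
    rw [hfin] at h
    refine ⟨c, hc, fun P hP hPδ => ?_⟩
    obtain ⟨f, hf, hle⟩ := h P hP hPδ
    exact ⟨f, hf.contDiff, hf.nonneg, hf.support_subset, hf.eq_zero, hf.norm_le, hle⟩
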